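/- For all nonnegative integers a and b, the number of partitions λ with distinct parts such that ℓ(λ) ≡ 1 or 2 (mod 4), λ_1 = a, and λ_1 + λ_5 + λ_9 + ⋯ = b equals ∑_{n≥1} T_n, where T_n is the number of quadruples (α¹, α², α³, α⁴) of partitions in which α¹ and α² have every part of size at most n, α³ and α⁴ have every part of size at most n−1, ℓ(α¹)+ℓ(α²)+ℓ(α³)+ℓ(α⁴) = a − (4n−3), and |α¹|+|α²|+|α³|+|α⁴| = b − (2n choose 2) (T_n = 0 when either quantity is negative; only finitely many T_n are nonzero). (This is the coefficient-wise form of the identity ∑ z^{λ_1} q^{λ_1+λ_5+λ_9+⋯} = ∑_{n≥1} q^{C(2n,2)} z^{4n−3}/((qz;q)_n² (qz;q)_{n−1}²), summed over distinct-part λ with ℓ(λ) ≡ 1 or 2 mod 4.) -/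

import Mathlib

/-- A partition: a weakly decreasing sequence of naturals with finite support.
`p.parts i` is the `(i+1)`-st part, i.e. parts are 0-indexed (`λ_1 = p.parts 0`). -/
structure Ptn where
  parts : ℕ → ℕ
  antitone' : ∀ ⦃i j : ℕ⦄, i ≤ j → parts j ≤ parts i
  finite_support' : (Function.support parts).Finite

namespace Ptn

/-- The size `|λ|` of a partition: the sum of all its parts. -/
noncomputable def size (p : Ptn) : ℕ := ∑ᶠ i, p.parts i

/-- The number of (nonzero) parts `ℓ(λ)`. -/
noncomputable def length (p : Ptn) : ℕ := (Function.support p.parts).ncard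

/-- A partition has distinct parts if no nonzero value is repeated. -/
def Distinct (p : Ptn) : Prop := ∀ i : ℕ, p.parts (i + 1) ≠ 0 → p.parts (i + 1) < p.parts i

/-- A partition has odd parts if every part is odd. -/
def OddParts (p : Ptn) : Prop := ∀ i : ℕ, p.parts i ≠ 0 → Odd (p.parts i)

end Ptn

/-- `T n a b`: the number of quadruples `(α¹, α², α³, α⁴)` of partitions, where `α¹, α²`
have every part of size at most `n` and `α³, α⁴` have every part of size at most `n - 1`,
with total length `a - (4n - 3)` and total size `b - (2n choose 2)`
(zero if either of these quantities is negative). -/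
noncomputable def T (n a b : ℕ) : ℕ :=
  {q : Ptn × Ptn × Ptn × Ptn |
      (∀ i, q.1.parts i ≤ n) ∧ (∀ i, q.2.1.parts i ≤ n) ∧
      (∀ i, q.2.2.1.parts i ≤ n - 1) ∧ (∀ i, q.2.2.2.parts i ≤ n - 1) ∧
      ((q.1.length : ℤ) + q.2.1.length + q.2.2.1.length + q.2.2.2.length
        = (a : ℤ) - (4 * (n : ℤ) - 3)) ∧
      ((q.1.size : ℤ) + q.2.1.size + q.2.2.1.size + q.2.2.2.size
        = (b : ℤ) - (n : ℤ) * (2 * (n : ℤ) - 1))}.ncard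

namespace Ptn

@[ext]
theorem ext_parts {p q : Ptn} (h : ∀ i, p.parts i = q.parts i) : p = q := by
  cases p; cases q
  congr
  exact funext h

theorem exists_forall_ge_eq_zero (p : Ptn) : ∃ N, ∀ i, N ≤ i → p.parts i = 0 := by
  obtain ⟨M, hM⟩ := p.finite_support'.bddAbove
  refine ⟨M + 1, fun i hi => ?_⟩
  by_contra h
  have := hM (Function.mem_support.mpr h)
  omega

theorem finite_support_of_forall_ge {f : ℕ → ℕ} {N : ℕ} (h : ∀ i, N ≤ i → f i = 0) :
    (Function.support f).Finite :=
  (Set.finite_lt_nat N).subset fun i hi => by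
    by_contra hc
    exact hi (h i (not_lt.mp hc))

theorem finsum_eq_sum_range {f : ℕ → ℕ} {N : ℕ} (h : ∀ i, N ≤ i → f i = 0) :
    ∑ᶠ i, f i = ∑ i ∈ Finset.range N, f i := by
  refine finsum_eq_sum_of_support_subset _ fun i hi => ?_
  by_contra hc
  exact hi (h i (by simpa using hc))

/-- The Ferrers-diagram conjugate of a partition. -/
noncomputable def conj (p : Ptn) : Ptn where
  parts j := sInf {i | p.parts i ≤ j}
  antitone' i j hij := by
    obtain ⟨N, hN⟩ := p.exists_forall_ge_eq_zero
    have hne : {k | p.parts k ≤ i}.Nonempty := ⟨N, by simp [hN N le_rfl]⟩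
    have hmem : p.parts (sInf {k | p.parts k ≤ i}) ≤ i := Nat.sInf_mem hne
    exact Nat.sInf_le (hmem.trans hij)
  finite_support' := by
    refine finite_support_of_forall_ge (N := p.parts 0) fun j hj => ?_
    exact Nat.le_zero.mp (Nat.sInf_le hj)

theorem lt_conj_parts_iff (p : Ptn) (i j : ℕ) : i < p.conj.parts j ↔ j < p.parts i := by
  constructor
  · intro h
    by_contra hc
    exact absurd (Nat.sInf_le (s := {i | p.parts i ≤ j}) (not_lt.mp hc)) (not_le.mpr h)
  · intro h
    by_contra hc
    obtain ⟨N, hN⟩ := p.exists_forall_ge_eq_zero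
    have hne : {k | p.parts k ≤ j}.Nonempty := ⟨N, by simp [hN N le_rfl]⟩
    have hmem : p.parts (p.conj.parts j) ≤ j := Nat.sInf_mem hne
    have := p.antitone' (not_lt.mp hc)
    omega

theorem conj_conj (p : Ptn) : p.conj.conj = p := by
  ext i
  refine eq_of_forall_lt_iff fun j => ?_
  rw [lt_conj_parts_iff, lt_conj_parts_iff]

theorem parts_ne_zero_iff (p : Ptn) (i : ℕ) : p.parts i ≠ 0 ↔ i < p.length := by
  have h : Function.support p.parts = Set.Iio (p.conj.parts 0) := by
    ext i
    simp [lt_conj_parts_iff, Nat.pos_iff_ne_zero]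
  have hl : p.length = p.conj.parts 0 := by
    rw [length, h, ← Finset.coe_Iio, Set.ncard_coe_finset, Nat.card_Iio]
  rw [hl, lt_conj_parts_iff, Nat.pos_iff_ne_zero]

theorem conj_parts_zero (p : Ptn) : p.conj.parts 0 = p.length := by
  refine eq_of_forall_lt_iff fun i => ?_
  rw [lt_conj_parts_iff, ← parts_ne_zero_iff, Nat.pos_iff_ne_zero]

theorem length_conj (p : Ptn) : p.conj.length = p.parts 0 := by
  rw [← conj_parts_zero, conj_conj]

theorem conj_parts_eq_zero_iff (p : Ptn) (n : ℕ) :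
    p.conj.parts n = 0 ↔ ∀ i, p.parts i ≤ n := by
  constructor
  · intro h i
    by_contra hc
    have := (p.lt_conj_parts_iff i n).mpr (not_le.mp hc)
    omega
  · intro h
    by_contra hc
    have := (p.lt_conj_parts_iff 0 n).mp (Nat.pos_of_ne_zero hc)
    have := h 0
    omega

theorem parts_eq_sum_ite (p : Ptn) {M : ℕ} (hM : p.parts 0 ≤ M) (i : ℕ) :
    p.parts i = ∑ j ∈ Finset.range M, if j < p.parts i then 1 else 0 := by
  have h : (Finset.range M).filter (fun j => j < p.parts i) = Finset.range (p.parts i) := by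
    ext j
    have := p.antitone' (Nat.zero_le i)
    simp only [Finset.mem_filter, Finset.mem_range]
    omega
  rw [← Finset.card_filter, h, Finset.card_range]

theorem size_conj (p : Ptn) : p.conj.size = p.size := by
  have hp : ∀ i, p.length ≤ i → p.parts i = 0 := fun i hi => by
    by_contra h
    have := (p.parts_ne_zero_iff i).mp h
    omega
  have hc : ∀ i, p.parts 0 ≤ i → p.conj.parts i = 0 := fun i hi => by
    by_contra h
    have := (p.conj.parts_ne_zero_iff i).mp h
    rw [length_conj] at this
    omega
  rw [size, size, finsum_eq_sum_range hp, finsum_eq_sum_range hc,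
    Finset.sum_congr rfl fun i _ => p.parts_eq_sum_ite le_rfl i,
    Finset.sum_congr rfl fun i _ => p.conj.parts_eq_sum_ite p.conj_parts_zero.le i,
    Finset.sum_comm]
  simp only [lt_conj_parts_iff]

/-- The partition whose successive differences interleave those of four given partitions. -/
def interleave (q : Ptn × Ptn × Ptn × Ptn) : Ptn where
  parts i := q.1.parts ((i + 3) / 4) + q.2.1.parts ((i + 2) / 4) +
    q.2.2.1.parts ((i + 1) / 4) + q.2.2.2.parts (i / 4)
  antitone' i j hij := by
    have h1 := q.1.antitone' (show (i + 3) / 4 ≤ (j + 3) / 4 by omega)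
    have h2 := q.2.1.antitone' (show (i + 2) / 4 ≤ (j + 2) / 4 by omega)
    have h3 := q.2.2.1.antitone' (show (i + 1) / 4 ≤ (j + 1) / 4 by omega)
    have h4 := q.2.2.2.antitone' (show i / 4 ≤ j / 4 by omega)
    omega
  finite_support' := by
    obtain ⟨N1, h1⟩ := q.1.exists_forall_ge_eq_zero
    obtain ⟨N2, h2⟩ := q.2.1.exists_forall_ge_eq_zero
    obtain ⟨N3, h3⟩ := q.2.2.1.exists_forall_ge_eq_zero
    obtain ⟨N4, h4⟩ := q.2.2.2.exists_forall_ge_eq_zero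
    refine finite_support_of_forall_ge (N := 4 * (N1 + N2 + N3 + N4)) fun i hi => ?_
    rw [h1 _ (by omega), h2 _ (by omega), h3 _ (by omega), h4 _ (by omega)]

theorem interleave_parts_four_mul (q : Ptn × Ptn × Ptn × Ptn) (k : ℕ) :
    (interleave q).parts (4 * k) =
      q.1.parts k + q.2.1.parts k + q.2.2.1.parts k + q.2.2.2.parts k := by
  have h1 : (4 * k + 3) / 4 = k := by omega
  have h2 : (4 * k + 2) / 4 = k := by omega
  have h3 : (4 * k + 1) / 4 = k := by omega
  have h4 : 4 * k / 4 = k := by omega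
  simp only [interleave, h1, h2, h3, h4]

theorem interleave_parts_four_mul_add_one (q : Ptn × Ptn × Ptn × Ptn) (k : ℕ) :
    (interleave q).parts (4 * k + 1) =
      q.1.parts (k + 1) + q.2.1.parts k + q.2.2.1.parts k + q.2.2.2.parts k := by
  have h1 : (4 * k + 1 + 3) / 4 = k + 1 := by omega
  have h2 : (4 * k + 1 + 2) / 4 = k := by omega
  have h3 : (4 * k + 1 + 1) / 4 = k := by omega
  have h4 : (4 * k + 1) / 4 = k := by omega
  simp only [interleave, h1, h2, h3, h4]

theorem interleave_parts_four_mul_add_two (q : Ptn × Ptn × Ptn × Ptn) (k : ℕ) :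
    (interleave q).parts (4 * k + 2) =
      q.1.parts (k + 1) + q.2.1.parts (k + 1) + q.2.2.1.parts k + q.2.2.2.parts k := by
  have h1 : (4 * k + 2 + 3) / 4 = k + 1 := by omega
  have h2 : (4 * k + 2 + 2) / 4 = k + 1 := by omega
  have h3 : (4 * k + 2 + 1) / 4 = k := by omega
  have h4 : (4 * k + 2) / 4 = k := by omega
  simp only [interleave, h1, h2, h3, h4]

theorem interleave_parts_four_mul_add_three (q : Ptn × Ptn × Ptn × Ptn) (k : ℕ) :
    (interleave q).parts (4 * k + 3) =
      q.1.parts (k + 1) + q.2.1.parts (k + 1) + q.2.2.1.parts (k + 1) + q.2.2.2.parts k := by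
  have h1 : (4 * k + 3 + 3) / 4 = k + 1 := by omega
  have h2 : (4 * k + 3 + 2) / 4 = k + 1 := by omega
  have h3 : (4 * k + 3 + 1) / 4 = k + 1 := by omega
  have h4 : (4 * k + 3) / 4 = k := by omega
  simp only [interleave, h1, h2, h3, h4]

theorem eq_of_differences_eq {p q : Ptn}
    (h : ∀ i, p.parts i + q.parts (i + 1) = q.parts i + p.parts (i + 1)) : p = q := by
  obtain ⟨N, hN⟩ := p.exists_forall_ge_eq_zero
  obtain ⟨M, hM⟩ := q.exists_forall_ge_eq_zero
  have key : ∀ i, p.parts i + q.parts 0 = q.parts i + p.parts 0 := by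
    intro i
    induction i with
    | zero => omega
    | succ k ih => have := h k; omega
  ext i
  have h1 := key i
  have h2 := key (N + M)
  rw [hN (N + M) (by omega), hM (N + M) (by omega)] at h2
  omega

theorem interleave_injective : Function.Injective interleave := by
  rintro ⟨p1, p2, p3, p4⟩ ⟨q1, q2, q3, q4⟩ h
  have h0 := fun k => congrArg (fun r : Ptn => r.parts (4 * k)) h
  have h1 := fun k => congrArg (fun r : Ptn => r.parts (4 * k + 1)) h
  have h2 := fun k => congrArg (fun r : Ptn => r.parts (4 * k + 2)) h
  have h3 := fun k => congrArg (fun r : Ptn => r.parts (4 * k + 3)) h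
  simp only [interleave_parts_four_mul, interleave_parts_four_mul_add_one,
    interleave_parts_four_mul_add_two, interleave_parts_four_mul_add_three] at h0 h1 h2 h3
  have e1 : p1 = q1 := eq_of_differences_eq fun i => by
    have := h0 i; have := h1 i; omega
  have e2 : p2 = q2 := eq_of_differences_eq fun i => by
    have := h1 i; have := h2 i; omega
  have e3 : p3 = q3 := eq_of_differences_eq fun i => by
    have := h2 i; have := h3 i; omega
  have e4 : p4 = q4 := eq_of_differences_eq fun i => by
    have := h3 i; have := h0 (i + 1); omega
  rw [e1, e2, e3, e4]

/-- A finitely supported sequence is the difference sequence of a partition. -/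
theorem exists_parts_eq_add {c : ℕ → ℕ} {N : ℕ} (hc : ∀ i, N ≤ i → c i = 0) :
    ∃ p : Ptn, ∀ i, p.parts i = c i + p.parts (i + 1) := by
  refine ⟨⟨fun j => ∑ i ∈ Finset.Ico j N, c i, fun i j hij => ?_,
    finite_support_of_forall_ge (N := N) fun i hi => by simp [hi]⟩, fun i => ?_⟩
  · exact Finset.sum_le_sum_of_subset (Finset.Ico_subset_Ico_left hij)
  · rcases lt_or_ge i N with h | h
    · exact Finset.sum_eq_sum_Ico_succ_bot h c
    · simp [hc i h, Finset.Ico_eq_empty_of_le h, Finset.Ico_eq_empty_of_le (h.trans i.le_succ)]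

theorem interleave_surjective : Function.Surjective interleave := by
  intro p
  obtain ⟨N, hN⟩ := p.exists_forall_ge_eq_zero
  have hd : ∀ r, ∃ q : Ptn, ∀ i, q.parts i =
      (p.parts (4 * i + r) - p.parts (4 * i + r + 1)) + q.parts (i + 1) := fun r =>
    exists_parts_eq_add (c := fun i => p.parts (4 * i + r) - p.parts (4 * i + r + 1)) (N := N)
      fun i hi => by rw [hN _ (by omega), Nat.zero_sub]
  choose q hq using hd
  refine ⟨(q 0, q 1, q 2, q 3), eq_of_differences_eq fun i => ?_⟩
  have hanti := p.antitone' (Nat.le_succ i)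
  obtain ⟨k, rfl | rfl | rfl | rfl⟩ : ∃ k, i = 4 * k ∨ i = 4 * k + 1 ∨ i = 4 * k + 2 ∨
      i = 4 * k + 3 := ⟨i / 4, by omega⟩
  · have := hq 0 k
    rw [interleave_parts_four_mul, interleave_parts_four_mul_add_one]
    simp only [Nat.succ_eq_add_one, add_zero] at *
    omega
  · have := hq 1 k
    rw [interleave_parts_four_mul_add_one, interleave_parts_four_mul_add_two]
    simp only [Nat.succ_eq_add_one] at *
    omega
  · have := hq 2 k
    rw [interleave_parts_four_mul_add_two, interleave_parts_four_mul_add_three]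
    simp only [Nat.succ_eq_add_one] at *
    omega
  · have := hq 3 k
    rw [interleave_parts_four_mul_add_three, show 4 * k + 3 + 1 = 4 * (k + 1) by ring,
      interleave_parts_four_mul]
    simp only [Nat.succ_eq_add_one, show 4 * k + 3 + 1 = 4 * (k + 1) by ring] at *
    omega

/-- Add the staircase `(m, m - 1, …, 1)` to a partition. -/
def addStaircase (m : ℕ) (p : Ptn) : Ptn where
  parts i := p.parts i + (m - i)
  antitone' i j hij := by
    have := p.antitone' hij
    omega
  finite_support' := by
    obtain ⟨N, hN⟩ := p.exists_forall_ge_eq_zero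
    refine finite_support_of_forall_ge (N := N + m) fun i hi => ?_
    rw [hN _ (by omega)]
    omega

theorem addStaircase_injective (m : ℕ) : Function.Injective (addStaircase m) := by
  intro p q h
  ext i
  have := congrArg (fun r : Ptn => r.parts i) h
  simpa [addStaircase] using this

theorem length_eq_iff (p : Ptn) (m : ℕ) :
    (p.length = m ∨ p.length = m + 1) ↔ (∀ i < m, p.parts i ≠ 0) ∧ p.parts (m + 1) = 0 := by
  simp only [parts_ne_zero_iff]
  constructor
  · intro h
    exact ⟨fun i hi => by omega, by
      by_contra hc
      have := (p.parts_ne_zero_iff _).mp hc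
      omega⟩
  · rintro ⟨h1, h2⟩
    have h3 : ¬ m + 1 < p.length := fun hc => (p.parts_ne_zero_iff _).mpr hc h2
    rcases Nat.eq_zero_or_pos m with h | h
    · omega
    · have := h1 (m - 1) (by omega)
      omega

/-- The partitions with distinct parts and `m` or `m + 1` parts are those with at most `m + 1`
parts plus a staircase. -/
theorem distinct_and_length_iff (p : Ptn) (m : ℕ) :
    (p.Distinct ∧ (p.length = m ∨ p.length = m + 1)) ↔
      ∃ r : Ptn, r.parts (m + 1) = 0 ∧ addStaircase m r = p := by
  rw [length_eq_iff]
  constructor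
  · rintro ⟨hd, hpos, hz⟩
    have hstep : ∀ i < m, p.parts (i + 1) + 1 ≤ p.parts i := fun i hi => by
      have := hpos i hi
      have := hd i
      omega
    have hge : ∀ k ≤ m, k ≤ p.parts (m - k) := by
      intro k
      induction k with
      | zero => omega
      | succ k ih =>
        intro hk
        have h1 := ih (by omega)
        have h2 := hstep (m - (k + 1)) (by omega)
        rw [show m - (k + 1) + 1 = m - k by omega] at h2
        omega
    have hge' : ∀ i, m - i ≤ p.parts i := fun i => by
      rcases le_total i m with h | h
      · have := hge (m - i) (by omega)
        rwa [show m - (m - i) = i by omega] at this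
      · omega
    refine ⟨⟨fun i => p.parts i - (m - i), antitone_nat_of_succ_le fun i => ?_,
      finite_support_of_forall_ge (N := m + 1) fun i hi => ?_⟩, ?_, ?_⟩
    · rcases lt_or_ge i m with h | h
      · have := hstep i h
        omega
      · have := p.antitone' (Nat.le_succ i)
        simp only [Nat.succ_eq_add_one] at this
        omega
    · have := p.antitone' hi
      omega
    · simp [hz]
    · ext i
      exact Nat.sub_add_cancel (hge' i)
  · rintro ⟨r, hr, rfl⟩
    refine ⟨fun i hi => ?_, fun i hi => ?_, ?_⟩
    · have h1 := r.antitone' (Nat.le_succ i)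
      rcases lt_or_ge i m with h | h
      · simp only [addStaircase, Nat.succ_eq_add_one] at *
        omega
      · have h2 := r.antitone' (show m + 1 ≤ i + 1 by omega)
        simp only [addStaircase] at *
        omega
    · simp only [addStaircase]
      omega
    · simp [addStaircase, hr]

theorem sum_staircase_four_mul (n : ℕ) :
    ∑ k ∈ Finset.range (n + 1), (4 * n + 1 - 4 * k) = (n + 1) * (2 * n + 1) := by
  rw [← Finset.sum_range_reflect]
  have h : ∀ j ∈ Finset.range (n + 1), 4 * n + 1 - 4 * (n + 1 - 1 - j) = 4 * j + 1 := by
    intro j hj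
    have := Finset.mem_range.mp hj
    omega
  rw [Finset.sum_congr rfl h]
  clear h
  induction n with
  | zero => simp
  | succ k ih => rw [Finset.sum_range_succ, ih]; ring

theorem finsum_addStaircase_four_mul (n : ℕ) (p : Ptn) :
    ∑ᶠ k, (addStaircase (4 * n + 1) p).parts (4 * k) =
      (∑ᶠ k, p.parts (4 * k)) + (n + 1) * (2 * n + 1) := by
  obtain ⟨N, hN⟩ := p.exists_forall_ge_eq_zero
  have hs : ∀ k, n + 1 ≤ k → 4 * n + 1 - 4 * k = 0 := fun k hk => by omega
  rw [← sum_staircase_four_mul, ← finsum_eq_sum_range hs]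
  exact finsum_add_distrib
    (finite_support_of_forall_ge (N := N) fun i hi => hN _ (by omega))
    (finite_support_of_forall_ge hs)

theorem finsum_interleave_four_mul (q : Ptn × Ptn × Ptn × Ptn) :
    ∑ᶠ k, (interleave q).parts (4 * k) =
      q.1.size + q.2.1.size + q.2.2.1.size + q.2.2.2.size := by
  simp only [interleave_parts_four_mul, size]
  have hf : ∀ p r : ℕ → ℕ, (Function.support p).Finite → (Function.support r).Finite →
      (Function.support fun i => p i + r i).Finite := fun p r hp hr =>
    (hp.union hr).subset (Function.support_add p r)
  rw [finsum_add_distrib, finsum_add_distrib, finsum_add_distrib]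
  all_goals first
    | exact Ptn.finite_support' _
    | exact hf _ _ (Ptn.finite_support' _) (Ptn.finite_support' _)
    | exact hf _ _ (hf _ _ (Ptn.finite_support' _) (Ptn.finite_support' _)) (Ptn.finite_support' _)

/-- Conjugation of each entry of a quadruple of partitions. -/
noncomputable def conjQuadruple (q : Ptn × Ptn × Ptn × Ptn) : Ptn × Ptn × Ptn × Ptn :=
  (q.1.conj, q.2.1.conj, q.2.2.1.conj, q.2.2.2.conj)

theorem conjQuadruple_involutive : Function.Involutive conjQuadruple := fun q => by
  simp [conjQuadruple, conj_conj]

theorem interleave_conjQuadruple_parts_eq_zero_iff (q : Ptn × Ptn × Ptn × Ptn) (n : ℕ) :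
    (interleave (conjQuadruple q)).parts (4 * n + 2) = 0 ↔
      (∀ i, q.1.parts i ≤ n + 1) ∧ (∀ i, q.2.1.parts i ≤ n + 1) ∧
        (∀ i, q.2.2.1.parts i ≤ n) ∧ (∀ i, q.2.2.2.parts i ≤ n) := by
  simp only [interleave_parts_four_mul_add_two, conjQuadruple, ← conj_parts_eq_zero_iff]
  omega

/-- The distinct-part partitions with `4n + 1` or `4n + 2` parts are counted by `T (n + 1)`. -/
theorem ncard_distinct_eq_T (n a b : ℕ) :
    {p : Ptn | (p.Distinct ∧ (p.length = 4 * n + 1 ∨ p.length = 4 * n + 1 + 1)) ∧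
        p.parts 0 = a ∧ (∑ᶠ k : ℕ, p.parts (4 * k)) = b}.ncard = T (n + 1) a b := by
  set F : Ptn × Ptn × Ptn × Ptn → Ptn := fun q =>
    addStaircase (4 * n + 1) (interleave (conjQuadruple q)) with hF
  have hinj : Function.Injective F := (addStaircase_injective _).comp
    (interleave_injective.comp conjQuadruple_involutive.injective)
  have hzero : ∀ q, (F q).parts 0 =
      q.1.length + q.2.1.length + q.2.2.1.length + q.2.2.2.length + (4 * n + 1) := fun q => by
    have := interleave_parts_four_mul (conjQuadruple q) 0
    simp only [conjQuadruple, conj_parts_zero, mul_zero] at this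
    simp only [hF, addStaircase, conjQuadruple, this, Nat.sub_zero]
  have hsum : ∀ q, ∑ᶠ k, (F q).parts (4 * k) =
      q.1.size + q.2.1.size + q.2.2.1.size + q.2.2.2.size + (n + 1) * (2 * n + 1) := fun q => by
    simp only [hF, finsum_addStaircase_four_mul, finsum_interleave_four_mul, conjQuadruple,
      size_conj]
  rw [T, ← Set.ncard_image_of_injective _ hinj]
  congr 1
  ext p
  simp only [Set.mem_ofPred_eq, Set.mem_image, distinct_and_length_iff, Nat.add_sub_cancel]
  have hb : ∀ s : ℕ, (s : ℤ) = (b : ℤ) - ((n + 1 : ℕ) : ℤ) * (2 * ((n + 1 : ℕ) : ℤ) - 1) ↔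
      s + (n + 1) * (2 * n + 1) = b := fun s => by
    rw [← Nat.cast_inj (R := ℤ)]
    push_cast
    constructor <;> intro h <;> linarith
  have ha : ∀ s : ℕ, (s : ℤ) = (a : ℤ) - (4 * ((n + 1 : ℕ) : ℤ) - 3) ↔
      s + (4 * n + 1) = a := fun s => by omega
  constructor
  · rintro ⟨⟨r, hr, rfl⟩, h0, hs⟩
    obtain ⟨t, rfl⟩ := interleave_surjective r
    obtain ⟨q, rfl⟩ := conjQuadruple_involutive.surjective t
    obtain ⟨h1, h2, h3, h4⟩ := (interleave_conjQuadruple_parts_eq_zero_iff q n).mp hr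
    refine ⟨q, ⟨h1, h2, h3, h4, ?_, ?_⟩, rfl⟩
    · exact_mod_cast (ha _).mpr ((hzero q).symm.trans h0)
    · exact_mod_cast (hb _).mpr ((hsum q).symm.trans hs)
  · rintro ⟨q, ⟨h1, h2, h3, h4, h5, h6⟩, rfl⟩
    refine ⟨⟨_, (interleave_conjQuadruple_parts_eq_zero_iff q n).mpr ⟨h1, h2, h3, h4⟩, rfl⟩, ?_, ?_⟩
    · rw [hzero, ← ha]
      exact_mod_cast h5
    · rw [hsum, ← hb]
      exact_mod_cast h6

theorem Distinct.length_le {p : Ptn} (hp : p.Distinct) : p.length ≤ p.parts 0 := by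
  obtain ⟨r, -, hr⟩ := (distinct_and_length_iff p p.length).mp ⟨hp, Or.inl rfl⟩
  have := congrArg (fun s : Ptn => s.parts 0) hr
  simp only [addStaircase] at this
  omega

theorem finite_setOf_distinct_parts_zero (a : ℕ) :
    {p : Ptn | p.Distinct ∧ p.parts 0 = a}.Finite := by
  refine Set.Finite.of_finite_image (f := fun (p : Ptn) (i : Fin a) => p.parts i) ?_ ?_
  · refine (Set.Finite.pi' fun _ : Fin a => Set.finite_le_nat a).subset ?_
    rintro _ ⟨p, ⟨-, rfl⟩, rfl⟩ i
    exact p.antitone' (Nat.zero_le _)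
  · rintro p ⟨hp, hpa⟩ q ⟨hq, hqa⟩ h
    ext i
    rcases lt_or_ge i a with hi | hi
    · exact congrFun h ⟨i, hi⟩
    · have := hp.length_le
      have := hq.length_le
      have := p.parts_ne_zero_iff i
      have := q.parts_ne_zero_iff i
      omega

end Ptn

/-- Coefficient-wise form of
`∑ z^{λ_1} q^{λ_1+λ_5+λ_9+⋯} = ∑_{n≥1} q^{C(2n,2)} z^{4n-3}/((qz;q)_n² (qz;q)_{n-1}²)`,
summed over distinct-part `λ` with `ℓ(λ) ≡ 1` or `2 (mod 4)`. -/
theorem mork_sum_identity_two (a b : ℕ) :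
    {p : Ptn | p.Distinct ∧ (p.length % 4 = 1 ∨ p.length % 4 = 2) ∧
        p.parts 0 = a ∧ (∑ᶠ k : ℕ, p.parts (4 * k)) = b}.ncard
      = ∑ᶠ n : ℕ, T (n + 1) a b := by
  classical
  set S := {p : Ptn | p.Distinct ∧ (p.length % 4 = 1 ∨ p.length % 4 = 2) ∧
        p.parts 0 = a ∧ (∑ᶠ k : ℕ, p.parts (4 * k)) = b} with hS
  have hfin : S.Finite :=
    (Ptn.finite_setOf_distinct_parts_zero a).subset fun p hp => ⟨hp.1, hp.2.2.1⟩
  have hfib : ∀ n, T (n + 1) a b = (hfin.toFinset.filter fun p => p.length / 4 = n).card := by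
    intro n
    rw [← Ptn.ncard_distinct_eq_T, ← Set.ncard_coe_finset]
    congr 1
    ext p
    have hl : (p.length = 4 * n + 1 ∨ p.length = 4 * n + 1 + 1) ↔
        (p.length % 4 = 1 ∨ p.length % 4 = 2) ∧ p.length / 4 = n := by omega
    simp only [Set.mem_ofPred_eq, Finset.coe_filter, Set.Finite.mem_toFinset, hS, hl]
    tauto
  have hle : ∀ p ∈ S, p.length / 4 < a + 1 := fun p hp => by
    have := hp.1.length_le
    have := hp.2.2.1
    omega
  rw [Ptn.finsum_eq_sum_range (N := a + 1), Set.ncard_eq_toFinset_card S hfin,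
    Finset.card_eq_sum_card_fiberwise (f := fun p => p.length / 4) (t := Finset.range (a + 1))]
  · exact Finset.sum_congr rfl fun n _ => (hfib n).symm
  · intro p hp
    simpa using hle p (by simpa using hp)
  · intro n hn
    rw [hfib, Finset.card_eq_zero, Finset.filter_eq_empty_iff]
    intro p hp
    have := hle p (by simpa using hp)
    omega
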